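/- arXiv:1309.7535 — 2 statements merged into one kernel-verified Lean document; each statement's English description precedes it below -/
import Mathlib

section
/- The 11x11 matrix T = A·B (with A block diagonal with upper-left block M = [[2,1,1,1],[-1,0,-1,-1],[-1,-1,0,-1],[-1,-1,-1,0]] and lower-right 7x7 identity, B the permutation matrix of (1)(9,10,11,2,3,4,5,6,7,8)) has a unique real eigenvalue λ with |λ| > 1, and this λ satisfies λ > 1. -/
open Matrix

/-- The Cremona matrix. -/
def M : Matrix (Fin 4) (Fin 4) ℝ :=
  !![2, 1, 1, 1; -1, 0, -1, -1; -1, -1, 0, -1; -1, -1, -1, 0]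

/-- Block diagonal matrix with blocks `M` and the 7×7 identity. -/
def A : Matrix (Fin 11) (Fin 11) ℝ :=
  Matrix.reindex finSumFinEquiv finSumFinEquiv (Matrix.fromBlocks M 0 0 (1 : Matrix (Fin 7) (Fin 7) ℝ))

/-- The permutation (1)(9,10,11,2,3,4,5,6,7,8) (in 1-indexed notation) of 11 coordinates. -/
def σ : Equiv.Perm (Fin 11) where
  toFun := ![0, 2, 3, 4, 5, 6, 7, 8, 9, 10, 1]
  invFun := ![0, 10, 1, 2, 3, 4, 5, 6, 7, 8, 9]
  left_inv := by decide
  right_inv := by decide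

/-- The permutation matrix of `σ`. -/
def B : Matrix (Fin 11) (Fin 11) ℝ := σ.permMatrix ℝ

/-- Lesieutre's matrix `T = A · B`. -/
def T : Matrix (Fin 11) (Fin 11) ℝ := A * B

/-- The intersection form `d² - m₁² - ⋯ - m₁₀²` on ℝ¹¹. -/
def q (v : Fin 11 → ℝ) : ℝ := v 0 ^ 2 - ∑ i : Fin 10, v i.succ ^ 2


/-- Explicit entries of `T`. -/
lemma T_mulVec (v : Fin 11 → ℝ) : T *ᵥ v =
    ![2 * v 0 + v 2 + v 3 + v 4, -v 0 - v 3 - v 4, -v 0 - v 2 - v 4, -v 0 - v 2 - v 3,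
      v 5, v 6, v 7, v 8, v 9, v 10, v 1] := by
  have hB : B *ᵥ v = ![v 0, v 2, v 3, v 4, v 5, v 6, v 7, v 8, v 9, v 10, v 1] := by
    funext i
    rw [B, Matrix.permMatrix_mulVec]
    fin_cases i <;> rfl
  have hA : A = !![2, 1, 1, 1, 0, 0, 0, 0, 0, 0, 0;
      -1, 0, -1, -1, 0, 0, 0, 0, 0, 0, 0;
      -1, -1, 0, -1, 0, 0, 0, 0, 0, 0, 0;
      -1, -1, -1, 0, 0, 0, 0, 0, 0, 0, 0;
      0, 0, 0, 0, 1, 0, 0, 0, 0, 0, 0;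
      0, 0, 0, 0, 0, 1, 0, 0, 0, 0, 0;
      0, 0, 0, 0, 0, 0, 1, 0, 0, 0, 0;
      0, 0, 0, 0, 0, 0, 0, 1, 0, 0, 0;
      0, 0, 0, 0, 0, 0, 0, 0, 1, 0, 0;
      0, 0, 0, 0, 0, 0, 0, 0, 0, 1, 0;
      0, 0, 0, 0, 0, 0, 0, 0, 0, 0, 1] := by
    rw [A]
    apply (Matrix.reindex finSumFinEquiv finSumFinEquiv).symm.injective
    rw [Equiv.symm_apply_apply]
    ext i j
    rcases i with i | i <;> rcases j with j | j
    · fin_cases i <;> fin_cases j <;> rfl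
    · fin_cases i <;> fin_cases j <;> rfl
    · fin_cases i <;> fin_cases j <;> rfl
    · fin_cases i <;> fin_cases j <;> rfl
  rw [T, ← Matrix.mulVec_mulVec, hB, hA]
  funext i
  fin_cases i <;> simp [Matrix.mulVec, dotProduct, Fin.sum_univ_succ] <;> ring

lemma mem_spec_iff (x : ℝ) :
    x ∈ spectrum ℝ T ↔ x ^ 11 - x ^ 9 - x ^ 8 + x ^ 3 + x ^ 2 - 1 = 0 := by
  rw [← Matrix.spectrum_toLin', ← Module.End.hasEigenvalue_iff_mem_spectrum]
  constructor
  · intro h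
    obtain ⟨v, hv⟩ := h.exists_hasEigenvector
    have h1 := hv.apply_eq_smul
    have h2 := hv.2
    rw [Matrix.toLin'_apply, T_mulVec] at h1
    have e0 : 2 * v 0 + v 2 + v 3 + v 4 = x * v 0 := congrFun h1 0
    have e1 : -v 0 - v 3 - v 4 = x * v 1 := congrFun h1 1
    have e2 : -v 0 - v 2 - v 4 = x * v 2 := congrFun h1 2
    have e3 : -v 0 - v 2 - v 3 = x * v 3 := congrFun h1 3
    have e4 : v 5 = x * v 4 := congrFun h1 4
    have e5 : v 6 = x * v 5 := congrFun h1 5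
    have e6 : v 7 = x * v 6 := congrFun h1 6
    have e7 : v 8 = x * v 7 := congrFun h1 7
    have e8 : v 9 = x * v 8 := congrFun h1 8
    have e9 : v 10 = x * v 9 := congrFun h1 9
    have e10 : v 1 = x * v 10 := congrFun h1 10
    have f1 : v 1 = x ^ 7 * v 4 := by rw [e10, e9, e8, e7, e6, e5, e4]; ring
    have g3 : v 3 = -v 0 - v 4 - x ^ 8 * v 4 := by rw [f1] at e1; linear_combination -e1
    have g2 : v 2 = (x - 1) * v 0 + x ^ 8 * v 4 := by linear_combination e0 - g3
    have g0 : v 0 = -(v 4) * (1 + x + x ^ 9) := by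
      rw [g2, g3] at e3; linear_combination e3
    have key : (x ^ 11 - x ^ 9 - x ^ 8 + x ^ 3 + x ^ 2 - 1) * v 4 = 0 := by
      rw [g2, g0] at e2; linear_combination e2
    rcases mul_eq_zero.1 key with h | h
    · exact h
    · exfalso
      apply h2
      have z0 : v 0 = 0 := by rw [g0, h]; ring
      funext i
      fin_cases i <;> simp [*]
  · intro h
    set w : Fin 11 → ℝ := ![-(1 + x + x ^ 9), x ^ 7,
      (x - 1) * (-(1 + x + x ^ 9)) + x ^ 8, x + x ^ 9 - x ^ 8,
      1, x, x ^ 2, x ^ 3, x ^ 4, x ^ 5, x ^ 6] with hw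
    refine Module.End.hasEigenvalue_of_hasEigenvector (x := w)
      ⟨Module.End.mem_eigenspace_iff.2 ?_, fun h0 => ?_⟩
    · rw [Matrix.toLin'_apply, T_mulVec]
      funext i
      fin_cases i <;> simp [hw]
      · ring
      · ring
      · linear_combination h
      all_goals ring
    · have : (1 : ℝ) = 0 := congrFun h0 4
      norm_num at this

lemma quintic {x : ℝ} (hx : 1 < x)
    (h : x ^ 11 - x ^ 9 - x ^ 8 + x ^ 3 + x ^ 2 - 1 = 0) :
    ∃ s : ℝ, 0 < s ∧ s * x = (x - 1) ^ 2 ∧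
      s ^ 5 + 11 * s ^ 4 + 43 * s ^ 3 + 69 * s ^ 2 + 36 * s = 1 := by
  have hx0 : x ≠ 0 := by linarith
  have hx1 : x - 1 ≠ 0 := by linarith
  have hL : x ^ 10 + x ^ 9 - x ^ 7 - x ^ 6 - x ^ 5 - x ^ 4 - x ^ 3 + x + 1 = 0 := by
    apply mul_left_cancel₀ hx1
    linear_combination h
  refine ⟨(x - 1) ^ 2 / x, by have := sub_pos.2 hx; positivity, by field_simp, ?_⟩
  field_simp
  linear_combination hL

/-- `T` has a unique real eigenvalue `λ` with `|λ| > 1`, and this eigenvalue satisfies `λ > 1`. -/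
theorem T_unique_large_eigenvalue :
    ∃ lam : ℝ, 1 < lam ∧ lam ∈ spectrum ℝ T ∧
      ∀ mu : ℝ, mu ∈ spectrum ℝ T → 1 < |mu| → mu = lam := by
  have hivt := intermediate_value_Icc (a := (1.1 : ℝ)) (b := 2) (by norm_num)
    (f := fun x : ℝ => x ^ 11 - x ^ 9 - x ^ 8 + x ^ 3 + x ^ 2 - 1) (by fun_prop)
  obtain ⟨l, hl, hl0⟩ := hivt (show (0 : ℝ) ∈ _ by constructor <;> norm_num)
  simp only at hl0
  have hl1 : 1 < l := by have := hl.1; norm_num at this; linarith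
  refine ⟨l, hl1, (mem_spec_iff l).2 hl0, fun m hm hm1 => ?_⟩
  rw [mem_spec_iff] at hm
  rcases lt_abs.1 hm1 with h | h
  · obtain ⟨s, hs, hsl, hs1⟩ := quintic hl1 hl0
    obtain ⟨t, ht, htm, ht1⟩ := quintic h hm
    have hst : s = t := by
      rcases lt_trichotomy s t with hlt | heq | hlt
      · exfalso
        have : s ^ 5 + 11 * s ^ 4 + 43 * s ^ 3 + 69 * s ^ 2 + 36 * s <
            t ^ 5 + 11 * t ^ 4 + 43 * t ^ 3 + 69 * t ^ 2 + 36 * t := by gcongr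
        linarith
      · exact heq
      · exfalso
        have : t ^ 5 + 11 * t ^ 4 + 43 * t ^ 3 + 69 * t ^ 2 + 36 * t <
            s ^ 5 + 11 * s ^ 4 + 43 * s ^ 3 + 69 * s ^ 2 + 36 * s := by gcongr
        linarith
    subst hst
    have hp : (m - l) * (m * l - 1) = 0 := by linear_combination m * hsl - l * htm
    rcases mul_eq_zero.1 hp with h' | h'
    · linarith
    · nlinarith
  · exfalso
    obtain ⟨y, rfl⟩ : ∃ y, m = -y := ⟨-m, by ring⟩
    rw [neg_neg] at h
    have h1 : y ^ 9 < y ^ 11 := pow_lt_pow_right₀ h (by norm_num)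
    have h2 : y ^ 2 < y ^ 8 := pow_lt_pow_right₀ h (by norm_num)
    have h3 : 0 < y ^ 3 := by positivity
    have : -y ^ 11 + y ^ 9 - y ^ 8 - y ^ 3 + y ^ 2 - 1 = 0 := by linear_combination hm
    linarith
end

section
/- Let T be the 11x11 matrix from Lesieutre's construction and let ℓ̄ = (1, 1, 1, 1, 0, 0, 0, 0, 0, 0, 0) ∈ R^11 (representing H - E1 - E2 - E3). Then for all natural numbers m ≠ n, T^m(ℓ̄) ≠ T^n(ℓ̄). -/
open Matrix

/-- The class `ℓ̄ = (1, 1, 1, 1, 0, 0, 0, 0, 0, 0, 0)` (representing `H - E₁ - E₂ - E₃`). -/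
def lbar : Fin 11 → ℝ := ![1, 1, 1, 1, 0, 0, 0, 0, 0, 0, 0]

theorem M_apply (y : Fin 4 → ℝ) : y ᵥ* M =
    ![2 * y 0 - y 1 - y 2 - y 3, y 0 - y 2 - y 3, y 0 - y 1 - y 3, y 0 - y 1 - y 2] := by
  funext i
  fin_cases i <;> simp [M, Matrix.vecHead, Matrix.vecTail] <;> ring

theorem A_apply_nat (x : Fin 11 → ℝ) : x ᵥ* A =
    ![2 * x 0 - x 1 - x 2 - x 3, x 0 - x 2 - x 3, x 0 - x 1 - x 3, x 0 - x 1 - x 2,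
      x 4, x 5, x 6, x 7, x 8, x 9, x 10] := by
  have h : x = Sum.elim (fun i : Fin 4 => x (Fin.castAdd 7 i)) (fun i : Fin 7 => x (Fin.natAdd 4 i))
      ∘ (finSumFinEquiv (m := 4) (n := 7)).symm := by
    funext i
    obtain ⟨j, rfl⟩ := (finSumFinEquiv (m := 4) (n := 7)).surjective i
    rcases j with j | j <;> simp [-finSumFinEquiv_apply_left, -finSumFinEquiv_apply_right] <;> rfl
  have h2 : x ᵥ* A = (Sum.elim (fun i : Fin 4 => x (Fin.castAdd 7 i))
      (fun i : Fin 7 => x (Fin.natAdd 4 i)) ᵥ*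
      (Matrix.fromBlocks M 0 0 (1 : Matrix (Fin 7) (Fin 7) ℝ)))
      ∘ (finSumFinEquiv (m := 4) (n := 7)).symm := by
    conv_lhs => rw [h]
    rw [A, Matrix.reindex_apply, Matrix.submatrix_vecMul_equiv]
    congr 1
  rw [h2, Matrix.vecMul_fromBlocks]
  funext i
  obtain ⟨j, rfl⟩ := (finSumFinEquiv (m := 4) (n := 7)).surjective i
  rcases j with j | j
  · have hs : finSumFinEquiv.symm (finSumFinEquiv (m := 4) (n := 7) (Sum.inl j)) = Sum.inl j :=
      Equiv.symm_apply_apply _ _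
    simp only [Function.comp_apply, hs, Sum.elim_inl, Function.comp_def, Sum.elim_inr,
      Matrix.vecMul_zero, add_zero, M_apply]
    fin_cases j <;> rfl
  · fin_cases j <;> simp <;> rfl

/-- A left eigenvector. -/
def wvec (t : ℝ) : Fin 11 → ℝ :=
  ![(t^2+t+1)*(t^8+1) + t^9+t+1, t^2+t+1, t^9+t+1, (t^2+t+1)*(t^8+1) - t*(t^9+t+1),
    (t^2+t+1)*t^7, (t^2+t+1)*t^6, (t^2+t+1)*t^5, (t^2+t+1)*t^4, (t^2+t+1)*t^3, (t^2+t+1)*t^2,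
    (t^2+t+1)*t]

/-- The (scaled) characteristic equation. -/
def chi (t : ℝ) : ℝ := (t-2) * ((t^2+t+1)*(t^8+1) + t^9+t+1) + (t^2+t+1) + (t^9+t+1)
    + ((t^2+t+1)*(t^8+1) - t*(t^9+t+1))

theorem exists_root : ∃ t : ℝ, 11/10 ≤ t ∧ t ≤ 12/10 ∧ chi t = 0 := by
  have hc : ContinuousOn chi (Set.Icc (11/10) (12/10)) := by
    unfold chi; fun_prop
  obtain ⟨t, ht, h0⟩ := intermediate_value_Icc (by norm_num) hc
    (show (0:ℝ) ∈ Set.Icc _ _ by constructor <;> norm_num [chi])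
  exact ⟨t, ht.1, ht.2, h0⟩

theorem wvec_T (t : ℝ) (h : chi t = 0) : wvec t ᵥ* T = t • wvec t := by
  rw [T, ← Matrix.vecMul_vecMul, A_apply_nat, B]
  funext i
  rw [Matrix.vecMul_permMatrix]
  unfold chi at h
  fin_cases i <;> simp [wvec, σ] <;> linarith

theorem wvec_pow (t : ℝ) (h : chi t = 0) (n : ℕ) : wvec t ᵥ* T ^ n = t ^ n • wvec t := by
  induction n with
  | zero => simp
  | succ n ih =>
    rw [pow_succ, ← Matrix.vecMul_vecMul, ih, Matrix.smul_vecMul, wvec_T t h, smul_smul, pow_succ]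

/-- The iterates of `ℓ̄` under `T` are pairwise distinct. -/
theorem T_iterates_of_lbar_distinct :
    ∀ m n : ℕ, m ≠ n → (T ^ m).mulVec lbar ≠ (T ^ n).mulVec lbar := by
  intro m n hmn he
  obtain ⟨t, h1, h2, h0⟩ := exists_root
  have key := congrArg (fun v => wvec t ⬝ᵥ v) he
  simp only [Matrix.dotProduct_mulVec, wvec_pow t h0, smul_dotProduct, smul_eq_mul] at key
  have hc : wvec t ⬝ᵥ lbar ≠ 0 := by
    have e : wvec t ⬝ᵥ lbar = (3 - t) * ((t^2+t+1)*(t^8+1) + t^9+t+1) + chi t := by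
      simp [dotProduct, Fin.sum_univ_succ, wvec, lbar, chi]
      ring
    rw [e, h0, add_zero]
    have : 0 < t := by linarith
    have : 0 < 3 - t := by linarith
    positivity
  have hp := mul_right_cancel₀ hc key
  exact hmn (pow_right_injective₀ (by linarith) (by linarith) hp)
end
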